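/- arXiv:1807.02664 — 2 statements merged into one kernel-verified Lean document; each statement's English description precedes it below -/
import Mathlib

section
/- Let X be a metric space and E an H^n-measurable subset of X. Then E is n-rectifiable (i.e., there exist measurable sets F_i ⊆ ℝ^n and Lipschitz maps f_i : F_i → X with H^n(E \ ⋃_{i=1}^∞ f_i(F_i)) = 0) if and only if there exist measurable sets G_i ⊆ ℝ^n and bi-Lipschitz maps g_i : G_i → X with H^n(E \ ⋃_{i=1}^∞ g_i(G_i)) = 0. -/
open MeasureTheory Metric Set Filter
open scoped ENNReal NNReal Topology

/-- An `H^n`-measurable set `E` in a metric space `X` is `n`-rectifiable if there are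
measurable sets `F i ⊆ ℝ^n` and Lipschitz maps `f i : F i → X` such that
`H^n (E \ ⋃ i, f i '' F i) = 0`. -/
def IsRectifiableSet (n : ℕ) {X : Type*} [MetricSpace X] [MeasurableSpace X] [BorelSpace X]
    (E : Set X) : Prop :=
  MeasurableSet E ∧
  ∃ (F : ℕ → Set (EuclideanSpace ℝ (Fin n))) (f : ℕ → EuclideanSpace ℝ (Fin n) → X),
    (∀ i, MeasurableSet (F i)) ∧ (∀ i, ∃ K : ℝ≥0, LipschitzOnWith K (f i) (F i)) ∧
    μH[n] (E \ ⋃ i, f i '' F i) = 0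

section DensityEstimate

variable {E : Type*} [NormedAddCommGroup E] [NormedSpace ℝ E] [FiniteDimensional ℝ E]
  [MeasurableSpace E] [BorelSpace E] (μ : Measure E) [μ.IsAddHaarMeasure]

theorem hasDerivAt_integral_closedBall_translate {φ : E → ℝ} {K : ℝ≥0} (hφ : LipschitzWith K φ)
    (x u : E) (ρ s : ℝ) :
    HasDerivAt (fun t : ℝ ↦ ∫ z in closedBall x ρ, φ (z + t • u) ∂μ)
      (∫ z in closedBall x ρ, fderiv ℝ φ (z + s • u) u ∂μ) s := by
  have hfin : IsFiniteMeasure (μ.restrict (closedBall x ρ)) :=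
    ⟨by simpa using measure_closedBall_lt_top⟩
  have hdiff : ∀ᵐ z ∂μ, DifferentiableAt ℝ φ (z + s • u) :=
    (measurePreserving_add_right μ (s • u)).quasiMeasurePreserving.ae hφ.ae_differentiableAt
  have hcont : ∀ t : ℝ, Continuous fun z ↦ φ (z + t • u) := fun t ↦
    hφ.continuous.comp (by fun_prop)
  refine (hasDerivAt_integral_of_dominated_loc_of_lip (bound := fun _ ↦ K * ‖u‖) univ_mem
    (Eventually.of_forall fun t ↦ (hcont t).aestronglyMeasurable)
    ((hcont s).continuousOn.integrableOn_compact (isCompact_closedBall x ρ)) ?_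
    (Eventually.of_forall fun z ↦ ?_) (integrable_const _) ?_).2
  · exact (((measurable_fderiv ℝ φ).comp (measurable_add_const _)).apply_continuousLinearMap
      u).aestronglyMeasurable
  · refine LipschitzOnWith.of_dist_le_mul fun a _ b _ ↦ ?_
    rw [Real.coe_nnabs, abs_of_nonneg (by positivity)]
    refine (hφ.dist_le_mul _ _).trans_eq ?_
    rw [dist_add_left, dist_eq_norm, ← sub_smul, norm_smul, Real.dist_eq, Real.norm_eq_abs]
    ring
  · refine ae_restrict_of_ae (hdiff.mono fun z hz ↦ ?_)
    have hline : HasDerivAt (fun t : ℝ ↦ z + t • u) u s := by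
      simpa using ((hasDerivAt_id s).smul_const u).const_add z
    exact hz.hasFDerivAt.comp_hasDerivAt s hline

theorem norm_integral_fderiv_translate_le {φ : E → ℝ} {K : ℝ≥0} (hφ : LipschitzWith K φ)
    {A : Set E} (hA : MeasurableSet A) (x u : E) {c : ℝ} (ρ : ℝ) {s : ℝ} (hs : s ∈ Icc (0 : ℝ) 1)
    (hder : ∀ z ∈ A, |fderiv ℝ φ z u| ≤ c) :
    ‖∫ z in closedBall x ρ, fderiv ℝ φ (z + s • u) u ∂μ‖ ≤
      |c| * μ.real (closedBall x ρ) + K * ‖u‖ * μ.real (Aᶜ ∩ closedBall x (ρ + ‖u‖)) := by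
  have hfin : IsFiniteMeasure (μ.restrict (closedBall x ρ)) :=
    ⟨by simpa using measure_closedBall_lt_top⟩
  have hS : MeasurableSet ((· + s • u) ⁻¹' Aᶜ) := (measurable_add_const _) hA.compl
  have hind : Integrable (((· + s • u) ⁻¹' Aᶜ).indicator fun _ ↦ (K * ‖u‖ : ℝ))
      (μ.restrict (closedBall x ρ)) := (integrable_const _).indicator hS
  refine (norm_integral_le_of_norm_le ((integrable_const |c|).add hind)
    (Eventually.of_forall fun z ↦ ?_)).trans ?_
  · by_cases hz : z + s • u ∈ A
    · simpa [hz] using (hder _ hz).trans (le_abs_self c)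
    · have := (fderiv ℝ φ (z + s • u)).le_of_opNorm_le
        (norm_fderiv_le_of_lipschitz ℝ hφ (x₀ := z + s • u)) u
      simp only [Pi.add_apply, indicator, mem_preimage, mem_compl_iff, hz, not_false_eq_true,
        if_true]
      linarith [abs_nonneg c]
  · rw [integral_add' (integrable_const _) hind, integral_indicator_const _ hS]
    simp only [integral_const, measureReal_restrict_apply .univ, univ_inter, smul_eq_mul]
    rw [measureReal_restrict_apply hS, mul_comm (μ.real _) |c|, mul_comm (μ.real _) (K * ‖u‖)]
    suffices hle : μ.real ((· + s • u) ⁻¹' Aᶜ ∩ closedBall x ρ) ≤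
        μ.real (Aᶜ ∩ closedBall x (ρ + ‖u‖)) by
      exact add_le_add_right (mul_le_mul_of_nonneg_left hle (by positivity)) _
    refine ENNReal.toReal_mono
      ((measure_mono inter_subset_right).trans_lt (measure_closedBall_lt_top (μ := μ))).ne ?_
    rw [← measure_preimage_add_right μ (s • u) (Aᶜ ∩ closedBall x (ρ + ‖u‖))]
    refine measure_mono fun z hz ↦ ⟨hz.1, ?_⟩
    have h1 : dist z x ≤ ρ := hz.2
    have h2 : ‖s • u‖ ≤ ‖u‖ := by
      rw [norm_smul, Real.norm_of_nonneg hs.1]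
      exact mul_le_of_le_one_left (norm_nonneg _) hs.2
    rw [mem_closedBall]
    calc dist (z + s • u) x ≤ dist (z + s • u) z + dist z x := dist_triangle _ _ _
      _ ≤ ρ + ‖u‖ := by rw [dist_self_add_left]; linarith

theorem abs_sub_mul_measureReal_closedBall_le {φ : E → ℝ} {K : ℝ≥0} (hφ : LipschitzWith K φ)
    {A : Set E} (hA : MeasurableSet A) (x u : E) {c : ℝ} (ρ : ℝ)
    (hder : ∀ z ∈ A, |fderiv ℝ φ z u| ≤ c) :
    |φ (x + u) - φ x| * μ.real (closedBall x ρ) ≤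
      (2 * K * ρ + |c|) * μ.real (closedBall x ρ) +
        K * ‖u‖ * μ.real (Aᶜ ∩ closedBall x (ρ + ‖u‖)) := by
  set B := closedBall x ρ
  set Ψ : ℝ → ℝ := fun t ↦ ∫ z in B, φ (z + t • u) ∂μ
  have hmv : ‖Ψ 1 - Ψ 0‖ ≤
      (|c| * μ.real B + K * ‖u‖ * μ.real (Aᶜ ∩ closedBall x (ρ + ‖u‖))) * ‖(1 : ℝ) - 0‖ :=
    (convex_Icc (0 : ℝ) 1).norm_image_sub_le_of_norm_hasDerivWithin_le
      (fun s _ ↦ (hasDerivAt_integral_closedBall_translate μ hφ x u ρ s).hasDerivWithinAt)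
      (fun s hs ↦ norm_integral_fderiv_translate_le μ hφ hA x u ρ hs hder) (by simp) (by simp)
  have hint : ∀ t : ℝ, IntegrableOn (fun z ↦ φ (z + t • u)) B μ := fun t ↦
    (hφ.continuous.comp (by fun_prop)).continuousOn.integrableOn_compact
      (isCompact_closedBall x ρ)
  have hconst : IntegrableOn (fun _ ↦ φ (x + u) - φ x) B μ :=
    integrableOn_const measure_closedBall_lt_top.ne
  have hclose : ‖∫ z in B, ((φ (x + u) - φ x) - (φ (z + (1 : ℝ) • u) - φ (z + (0 : ℝ) • u))) ∂μ‖ ≤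
      2 * K * ρ * μ.real B := by
    refine norm_setIntegral_le_of_norm_le_const measure_closedBall_lt_top fun z hz ↦ ?_
    have hz : dist x z ≤ ρ := by rw [dist_comm]; exact hz
    have h1 := hφ.dist_le_mul (x + u) (z + u)
    have h2 := hφ.dist_le_mul x z
    rw [dist_add_right, Real.dist_eq] at h1
    rw [Real.dist_eq] at h2
    have h3 : (K : ℝ) * dist x z ≤ K * ρ := by gcongr
    rw [Real.norm_eq_abs, one_smul, zero_smul, add_zero, abs_le]
    rw [abs_le] at h1 h2
    constructor <;> linarith
  have hsplit := integral_sub hconst ((hint 1).sub (hint 0))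
  simp only [Pi.sub_apply] at hsplit
  rw [hsplit, integral_sub (hint 1) (hint 0), setIntegral_const, smul_eq_mul] at hclose
  rw [sub_zero, norm_one, mul_one] at hmv
  change ‖_ - (Ψ 1 - Ψ 0)‖ ≤ _ at hclose
  have htri := norm_le_norm_add_norm_sub (Ψ 1 - Ψ 0) (μ.real B * (φ (x + u) - φ x))
  rw [norm_mul, Real.norm_of_nonneg measureReal_nonneg, Real.norm_eq_abs (φ _ - _)] at htri
  rw [norm_sub_rev] at hclose
  nlinarith

theorem exists_forall_abs_sub_le_of_density {A : Set E} (hA : MeasurableSet A) {x : E}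
    (hx : Tendsto (fun r ↦ μ (Aᶜ ∩ closedBall x r) / μ (closedBall x r)) (𝓝[>] 0) (𝓝 0))
    (K : ℝ≥0) {η : ℝ} (hη : 0 < η) :
    ∃ r > 0, ∀ φ : E → ℝ, LipschitzWith K φ → ∀ u : E, ‖u‖ < r → ∀ c : ℝ, 0 ≤ c →
      (∀ z ∈ A, |fderiv ℝ φ z u| ≤ c) → |φ (x + u) - φ x| ≤ c + η * ‖u‖ := by
  set d := Module.finrank ℝ E
  set δ : ℝ := η / (4 * (K + 1))
  have hK : (0 : ℝ) ≤ K := K.2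
  have hδ : 0 < δ := by positivity
  have hδK : 2 * K * δ ≤ η / 2 := by
    have : δ * (4 * (K + 1)) = η := div_mul_cancel₀ _ (by positivity)
    nlinarith
  set M : ℝ := ((1 + δ) / δ) ^ d
  have hM : 0 < M := by positivity
  set η' : ℝ := η / (2 * (K + 1) * M)
  have hη' : 0 < η' := by positivity
  have hηK : K * (η' * M) ≤ η / 2 := by
    have : η' * (2 * (K + 1) * M) = η := div_mul_cancel₀ _ (by positivity)
    have : 0 < η' * M := by positivity
    nlinarith
  have hev := hx.eventually (gt_mem_nhds (ENNReal.ofReal_pos.2 hη'))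
  obtain ⟨r, hr, hrs⟩ := mem_nhdsGT_iff_exists_Ioo_subset.1 hev
  have hr : 0 < r := hr
  refine ⟨r / (1 + δ), by positivity, fun φ hφ u hu c hc hder ↦ ?_⟩
  rcases eq_or_ne u 0 with rfl | hu0
  · simpa using hc
  have hupos : 0 < ‖u‖ := norm_pos_iff.2 hu0
  have hRr : δ * ‖u‖ + ‖u‖ < r := by
    rw [lt_div_iff₀ (by positivity)] at hu
    linarith
  have hRpos : 0 < δ * ‖u‖ + ‖u‖ := by positivity
  have hdens : μ (Aᶜ ∩ closedBall x (δ * ‖u‖ + ‖u‖)) / μ (closedBall x (δ * ‖u‖ + ‖u‖)) <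
    ENNReal.ofReal η' := hrs ⟨hRpos, hRr⟩
  have hballs : μ.real (closedBall x (δ * ‖u‖ + ‖u‖)) = M * μ.real (closedBall x (δ * ‖u‖)) := by
    have : δ * ‖u‖ + ‖u‖ = (1 + δ) / δ * (δ * ‖u‖) := by field_simp; ring
    rw [this, measureReal_def, Measure.addHaar_closedBall_mul μ x (by positivity) (by positivity),
      ENNReal.toReal_mul, ENNReal.toReal_ofReal (by positivity), measureReal_def,
      Measure.addHaar_closedBall_center μ x]
  have hdens' : μ.real (Aᶜ ∩ closedBall x (δ * ‖u‖ + ‖u‖)) ≤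
      η' * (M * μ.real (closedBall x (δ * ‖u‖))) := by
    rw [ENNReal.div_lt_iff (.inl (measure_closedBall_pos μ x hRpos).ne')
      (.inl measure_closedBall_lt_top.ne)] at hdens
    rw [← hballs, measureReal_def, measureReal_def, ← ENNReal.toReal_ofReal hη'.le,
      ← ENNReal.toReal_mul]
    exact ENNReal.toReal_mono
      (ENNReal.mul_lt_top ENNReal.ofReal_lt_top measure_closedBall_lt_top).ne hdens.le
  have hmain := abs_sub_mul_measureReal_closedBall_le μ hφ hA x u (δ * ‖u‖) hder
  have hpos : 0 < μ.real (closedBall x (δ * ‖u‖)) :=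
    ENNReal.toReal_pos (measure_closedBall_pos μ x (by positivity)).ne'
      measure_closedBall_lt_top.ne
  rw [abs_of_nonneg hc] at hmain
  refine le_of_mul_le_mul_right (hmain.trans ?_) hpos
  set m := μ.real (closedBall x (δ * ‖u‖))
  calc _ ≤ (2 * K * (δ * ‖u‖) + c) * m + K * ‖u‖ * (η' * (M * m)) := by gcongr
    _ = (c + (2 * K * δ + K * (η' * M)) * ‖u‖) * m := by ring
    _ ≤ (c + (η / 2 + η / 2) * ‖u‖) * m := by gcongr
    _ = _ := by ring

end DensityEstimate

section ControlsDistOn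

variable {X : Type*} [MetricSpace X]

/-- The sequence `φ` of real functions controls the distances between the values of `f` on `A`. -/
def ControlsDistOn {E : Type*} (φ : ℕ → E → ℝ) (f : E → X) (A : Set E) : Prop :=
  ∀ x ∈ A, ∀ y ∈ A, ∀ c : ℝ, (∀ j, |φ j x - φ j y| ≤ c) → dist (f x) (f y) ≤ c

theorem ControlsDistOn.mono {E : Type*} {φ : ℕ → E → ℝ} {f : E → X} {A B : Set E}
    (h : ControlsDistOn φ f B) (hAB : A ⊆ B) : ControlsDistOn φ f A :=
  fun x hx y hy ↦ h x (hAB hx) y (hAB hy)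

theorem ControlsDistOn.lipschitzOnWith {E : Type*} [NormedAddCommGroup E] {φ : ℕ → E → ℝ}
    {f : E → X} {A : Set E} {K : ℝ≥0}
    (h : ControlsDistOn φ f A) (hφ : ∀ j, LipschitzWith K (φ j)) : LipschitzOnWith K f A :=
  LipschitzOnWith.of_dist_le_mul fun x hx y hy ↦ h x hx y hy _ fun j ↦ (hφ j).dist_le_mul x y

end ControlsDistOn

theorem measure_image_le_of_subset_iUnion {X E : Type*} [MeasurableSpace X]
    [MeasurableSpace E] {μ : Measure E} {ν : Measure X} {f : E → X} {A : Set E} (hA : MeasurableSet A) {Q : ℕ → Set E}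
    (hQ : ∀ i, MeasurableSet (Q i)) (hAQ : A ⊆ ⋃ i, Q i) {C : ℝ≥0∞}
    (h : ∀ i, ∀ D ⊆ A ∩ Q i, MeasurableSet D → ν (f '' D) ≤ C * μ D) :
    ν (f '' A) ≤ C * μ A := by
  have hm : ∀ i, MeasurableSet (A ∩ disjointed Q i) := fun i ↦
    hA.inter (MeasurableSet.disjointed hQ i)
  have hU : A = ⋃ i, A ∩ disjointed Q i := by
    rw [← inter_iUnion, iUnion_disjointed, inter_eq_left.2 hAQ]
  calc ν (f '' A) = ν (⋃ i, f '' (A ∩ disjointed Q i)) := by rw [← image_iUnion, ← hU]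
    _ ≤ ∑' i, ν (f '' (A ∩ disjointed Q i)) := measure_iUnion_le _
    _ ≤ ∑' i, C * μ (A ∩ disjointed Q i) := ENNReal.tsum_le_tsum fun i ↦
        h i _ (inter_subset_inter_right _ (disjointed_subset Q i)) (hm i)
    _ = C * μ A := by
        rw [ENNReal.tsum_mul_left, ← measure_iUnion (fun i j hij ↦
          (disjoint_disjointed Q hij).mono inter_subset_right inter_subset_right) hm, ← hU]

theorem exists_small_det_dominating {E : Type*} [NormedAddCommGroup E] [InnerProductSpace ℝ E]
    [FiniteDimensional ℝ E] {v : E} (hv : v ≠ 0) (K : ℝ≥0) {ε : ℝ} (hε : 0 < ε) :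
    ∃ T : E →L[ℝ] E, |T.det| < ε ∧ Function.Injective T ∧
      ∀ S : E →L[ℝ] ℝ, ‖S‖ ≤ K → S v = 0 → ∀ u, 2 * |S u| ≤ ‖T u‖ := by
  set P : E →L[ℝ] E := (ℝ ∙ v)ᗮ.starProjection
  have hPv : P v = 0 := by
    refine (Submodule.starProjection_apply_eq_zero_iff _).2 ?_
    rw [Submodule.orthogonal_orthogonal]
    exact Submodule.mem_span_singleton_self v
  have hPP : ∀ u, P (P u) = P u := fun u ↦
    Submodule.starProjection_eq_self_iff.2 (Submodule.starProjection_apply_mem _ u)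
  have hPn : ∀ u, ‖P u‖ ≤ ‖u‖ := fun u ↦ Submodule.norm_starProjection_apply_le _ u
  set T : ℝ → E →L[ℝ] E := fun t ↦ (2 * K : ℝ) • P + t • ContinuousLinearMap.id ℝ E
  have hdet0 : (T 0).det = 0 := by
    by_contra h
    have : T 0 v = 0 := by simp [T, hPv]
    exact hv ((LinearMap.equivOfDetNeZero _ h).injective (by simpa using this))
  have hcont : Continuous fun t ↦ |(T t).det| := by
    have : Continuous T := by fun_prop
    exact (ContinuousLinearMap.continuous_det.comp this).abs
  have hev : ∀ᶠ t in 𝓝[>] (0 : ℝ), |(T t).det| < ε :=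
    nhdsWithin_le_nhds (hcont.continuousAt.eventually (gt_mem_nhds (by simpa [hdet0] using hε)))
  obtain ⟨t, htε, ht⟩ := (hev.and self_mem_nhdsWithin).exists
  have ht : 0 < t := ht
  have hK : (0 : ℝ) ≤ K := K.2
  have hTP : ∀ u, 2 * K * ‖P u‖ + t * ‖P u‖ ≤ ‖T t u‖ := fun u ↦ by
    have h1 : P (T t u) = (2 * K + t) • P u := by simp [T, hPP, add_smul]
    have h2 := hPn (T t u)
    rw [h1, norm_smul, Real.norm_of_nonneg (by positivity)] at h2
    linarith
  refine ⟨T t, htε, (injective_iff_map_eq_zero _).2 fun u hu ↦ ?_, fun S hS hSv u ↦ ?_⟩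
  · have h1 := hTP u
    rw [hu, norm_zero] at h1
    have h2 : P u = 0 := by
      rw [← norm_le_zero_iff]
      have : 0 ≤ 2 * K * ‖P u‖ := by positivity
      by_contra! h
      nlinarith
    simpa [T, h2, ht.ne'] using hu
  · have h1 : S u = S (P u) := by
      have : u - P u ∈ (ℝ ∙ v) := by
        have h := Submodule.sub_starProjection_mem_orthogonal (K := (ℝ ∙ v)ᗮ) u
        rwa [Submodule.orthogonal_orthogonal] at h
      obtain ⟨a, ha⟩ := Submodule.mem_span_singleton.1 this
      rw [← sub_eq_zero, ← map_sub, ← ha, map_smul, hSv, smul_zero]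
    have h2 : |S (P u)| ≤ K * ‖P u‖ := S.le_of_opNorm_le hS (P u)
    have : 0 ≤ t * ‖P u‖ := by positivity
    rw [h1]
    linarith [hTP u]

section CollapsedSet

variable {X : Type*} [MetricSpace X] [MeasurableSpace X] [BorelSpace X]

theorem LipschitzOnWith.hausdorffMeasure_image_eq_zero {Y : Type*} [MetricSpace Y]
    [MeasurableSpace Y] [BorelSpace Y] {K : ℝ≥0} {f : Y → X} {s : Set Y}
    (hf : LipschitzOnWith K f s) {d : ℝ} (hd : 0 ≤ d) (hs : μH[d] s = 0) :
    μH[d] (f '' s) = 0 := by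
  simpa [hs] using hf.hausdorffMeasure_image_le hd

variable {E : Type*} [NormedAddCommGroup E] [InnerProductSpace ℝ E] [FiniteDimensional ℝ E]
  [MeasurableSpace E] [BorelSpace E]

theorem hausdorffMeasure_image_le_det {φ : ℕ → E → ℝ} {f : E → X} {A : Set E} {K : ℝ≥0}
    (hA : MeasurableSet A) (hφ : ∀ j, LipschitzWith K (φ j)) (hf : ControlsDistOn φ f A)
    (T : E →L[ℝ] E) {C : ℝ} (hT : ∀ u, ‖u‖ ≤ C * ‖T u‖)
    (hder : ∀ x ∈ A, ∀ j, ∀ u, |fderiv ℝ (φ j) x u| ≤ ‖T u‖) :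
    μH[Module.finrank ℝ E] (f '' A) ≤
      2 ^ Module.finrank ℝ E * ENNReal.ofReal |T.det| * μH[Module.finrank ℝ E] A := by
  set d := Module.finrank ℝ E
  set μ : Measure E := μH[d]
  have : μ.IsAddHaarMeasure := isAddHaarMeasure_hausdorffMeasure
  set P : ℕ → Set E := fun m ↦
    {x | ∀ j, ∀ u, ‖u‖ < 1 / (m + 1) → |φ j (x + u) - φ j x| ≤ 2 * ‖T u‖}
  have hP : ∀ m, IsClosed (P m) := fun m ↦ by
    simp only [P, ofPred_forall]
    refine isClosed_iInter fun j ↦ isClosed_iInter fun u ↦ isClosed_iInter fun _ ↦ ?_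
    have := (hφ j).continuous
    exact isClosed_le (by fun_prop) continuous_const
  set p := TopologicalSpace.denseSeq E
  set Q : ℕ → Set E := fun i ↦ P i.unpair.1 ∩ ball (p i.unpair.2) (1 / (2 * (i.unpair.1 + 1)))
  have hQ : ∀ i, MeasurableSet (Q i) := fun i ↦ (hP _).measurableSet.inter measurableSet_ball
  have hPQ : ∀ m, P m ⊆ ⋃ i, Q i := fun m x hx ↦ by
    obtain ⟨k, hk⟩ := (TopologicalSpace.denseRange_denseSeq E).exists_dist_lt x
      (show (0 : ℝ) < 1 / (2 * (m + 1)) by positivity)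
    exact mem_iUnion.2 ⟨Nat.pair m k, by simpa [Q] using ⟨hx, by simpa using hk⟩⟩
  have hnull : μ (A \ ⋃ i, Q i) = 0 := by
    have hae := Besicovitch.ae_tendsto_measure_inter_div_of_measurableSet μ hA.compl
    refine measure_eq_zero_iff_ae_notMem.2 (hae.mono fun x hxd hx ↦ hx.2 ?_)
    rw [indicator_of_notMem (by simpa using hx.1)] at hxd
    have hη : (0 : ℝ) < 1 / (|C| + 1) := by positivity
    obtain ⟨r, hr, hrφ⟩ := exists_forall_abs_sub_le_of_density μ hA hxd K hη
    obtain ⟨m, hm⟩ := exists_nat_one_div_lt hr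
    refine hPQ m fun j u hu ↦ (hrφ (φ j) (hφ j) u (hu.trans hm) ‖T u‖ (norm_nonneg _)
      fun z hz ↦ hder z hz j u).trans ?_
    have h1 : ‖u‖ ≤ (|C| + 1) * ‖T u‖ := (hT u).trans (by
      gcongr; linarith [le_abs_self C])
    have h2 : 1 / (|C| + 1) * ‖u‖ ≤ ‖T u‖ := by
      rw [one_div, inv_mul_le_iff₀ (by positivity)]; exact h1
    linarith
  have hmain : μH[d] (f '' (A ∩ ⋃ i, Q i)) ≤
      2 ^ d * ENNReal.ofReal |T.det| * μ (A ∩ ⋃ i, Q i) := by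
    refine measure_image_le_of_subset_iUnion (hA.inter (.iUnion hQ)) hQ inter_subset_right
      fun i D hD _ ↦ ?_
    have hTinj : Function.Injective T := by
      refine (injective_iff_map_eq_zero T).2 fun u hu ↦ norm_le_zero_iff.1 ?_
      simpa [hu] using hT u
    have hlip : LipschitzOnWith 2 (f ∘ Function.invFun T) (T '' D) := by
      refine LipschitzOnWith.of_dist_le_mul ?_
      rintro _ ⟨x, hx, rfl⟩ _ ⟨y, hy, rfl⟩
      simp only [Function.comp_apply, Function.leftInverse_invFun hTinj _]
      refine hf x (hD hx).1.1 y (hD hy).1.1 _ fun j ↦ ?_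
      have hxy : ‖y - x‖ < 1 / (i.unpair.1 + 1) := by
        rw [← dist_eq_norm]
        calc dist y x ≤ dist y (p i.unpair.2) + dist x (p i.unpair.2) :=
              dist_triangle_right _ _ _
          _ < 1 / (2 * (i.unpair.1 + 1)) + 1 / (2 * (i.unpair.1 + 1)) :=
              add_lt_add (hD hy).2.2 (hD hx).2.2
          _ = _ := by field_simp; norm_num
      have := (hD hx).2.1 j (y - x) hxy
      rwa [add_sub_cancel, abs_sub_comm, map_sub, ← dist_eq_norm, dist_comm] at this
    have himg : f '' D = (f ∘ Function.invFun T) '' (T '' D) := by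
      rw [image_comp, ← image_comp _ T, (Function.leftInverse_invFun hTinj).comp_eq_id, image_id]
    calc μH[d] (f '' D) ≤ (2 : ℝ≥0) ^ (d : ℝ) * μ (T '' D) := by
          rw [himg]; exact hlip.hausdorffMeasure_image_le (Nat.cast_nonneg d)
      _ = 2 ^ d * ENNReal.ofReal |T.det| * μ D := by
          rw [Measure.addHaar_image_continuousLinearMap, ENNReal.rpow_natCast, mul_assoc]
          rfl
  calc μH[d] (f '' A) = μH[d] (f '' (A ∩ ⋃ i, Q i) ∪ f '' (A \ ⋃ i, Q i)) := by
        rw [← image_union, inter_union_sdiff]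
    _ ≤ μH[d] (f '' (A ∩ ⋃ i, Q i)) + μH[d] (f '' (A \ ⋃ i, Q i)) := measure_union_le _ _
    _ = μH[d] (f '' (A ∩ ⋃ i, Q i)) := by
        rw [((hf.lipschitzOnWith hφ).mono sdiff_subset).hausdorffMeasure_image_eq_zero
          (Nat.cast_nonneg d) hnull, add_zero]
    _ ≤ _ := hmain.trans (by gcongr; exact inter_subset_left)

theorem hausdorffMeasure_image_eq_zero_of_degenerate {φ : ℕ → E → ℝ} {f : E → X} {B : Set E}
    {K : ℝ≥0} (hB : MeasurableSet B) (hφ : ∀ j, LipschitzWith K (φ j))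
    (hf : ControlsDistOn φ f B)
    (hdeg : ∀ x ∈ B, ∃ v : E, v ≠ 0 ∧ ∀ j, fderiv ℝ (φ j) x v = 0) :
    μH[Module.finrank ℝ E] (f '' B) = 0 := by
  set d := Module.finrank ℝ E
  set μ : Measure E := μH[d]
  have : μ.IsAddHaarMeasure := isAddHaarMeasure_hausdorffMeasure
  set T := TopologicalSpace.denseSeq (E →L[ℝ] E)
  have hbound : ∀ B' ⊆ B, MeasurableSet B' → ∀ ε : ℝ, 0 < ε →
      μH[d] (f '' B') ≤ 2 ^ d * ENNReal.ofReal ε * μ B' := by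
    intro B' hBB' hB' ε hε
    set Q : ℕ → Set E := fun k ↦ {_x | |(T k).det| < ε ∧ ∃ C : ℝ, ∀ u, ‖u‖ ≤ C * ‖T k u‖} ∩
      ⋂ j, fderiv ℝ (φ j) ⁻¹' {S | ∀ u, |S u| ≤ ‖T k u‖}
    refine measure_image_le_of_subset_iUnion hB' (Q := Q) (fun k ↦ ?_) (fun x hx ↦ ?_)
      fun k D hD hDm ↦ ?_
    · refine (MeasurableSet.const _).inter ?_
      refine MeasurableSet.iInter fun j ↦ ?_
      have hcl : IsClosed {S : E →L[ℝ] ℝ | ∀ u, |S u| ≤ ‖T k u‖} := by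
        rw [ofPred_forall]
        exact isClosed_iInter fun u ↦ isClosed_le (by fun_prop) continuous_const
      exact (measurable_fderiv ℝ (φ j)) hcl.measurableSet
    · obtain ⟨v, hv, hv0⟩ := hdeg x (hBB' hx)
      obtain ⟨S, hSdet, hSinj, hS⟩ := exists_small_det_dominating hv K hε
      obtain ⟨c, hc, hSc⟩ := (LinearMap.injective_iff_antilipschitz (S : E →ₗ[ℝ] E)).1 hSinj
      have hSc : ∀ u, ‖u‖ ≤ c * ‖S u‖ := fun u ↦ by
        simpa [dist_eq_norm] using hSc.le_mul_dist u 0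
      have hc : (0 : ℝ) < c := hc
      have hopen : IsOpen ({R : E →L[ℝ] E | |R.det| < ε} ∩ ball S (1 / (2 * c))) :=
        (isOpen_lt ContinuousLinearMap.continuous_det.abs continuous_const).inter isOpen_ball
      obtain ⟨k, hk⟩ := (TopologicalSpace.denseRange_denseSeq (E →L[ℝ] E)).exists_mem_open hopen
        ⟨S, hSdet, mem_ball_self (by positivity)⟩
      have hhalf : ∀ u, ‖S u‖ ≤ 2 * ‖T k u‖ := fun u ↦ by
        have h1 : ‖S - T k‖ ≤ 1 / (2 * c) := by
          rw [← dist_eq_norm, dist_comm]; exact (mem_ball.1 hk.2).le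
        have h2 : ‖S u - T k u‖ ≤ 1 / (2 * c) * ‖u‖ := (S - T k).le_of_opNorm_le h1 u
        have h3 : 1 / (2 * c) * ‖u‖ ≤ 1 / (2 * c) * (c * ‖S u‖) := by gcongr; exact hSc u
        have h4 : 1 / (2 * c) * (c * ‖S u‖) = ‖S u‖ / 2 := by field_simp
        linarith [norm_le_norm_add_norm_sub' (S u) (T k u)]
      refine mem_iUnion.2 ⟨k, ⟨hk.1, c * 2, fun u ↦ ?_⟩, mem_iInter.2 fun j u ↦ ?_⟩
      · rw [mul_assoc]
        exact (hSc u).trans (by gcongr; exact hhalf u)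
      · linarith [hhalf u, hS (fderiv ℝ (φ j) x) (norm_fderiv_le_of_lipschitz ℝ (hφ j))
          (hv0 j) u]
    · rcases D.eq_empty_or_nonempty with rfl | ⟨y, hy⟩
      · simp
      obtain ⟨hdet, C, hC⟩ := (hD hy).2.1
      refine (hausdorffMeasure_image_le_det hDm hφ (hf.mono ((hD.trans inter_subset_left).trans
        hBB')) (T k) hC fun x hx ↦ mem_iInter.1 (hD hx).2.2).trans ?_
      gcongr
  have hpiece : ∀ m : ℕ, μH[d] (f '' (B ∩ closedBall 0 m)) = 0 := fun m ↦ by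
    have hfin : μ (B ∩ closedBall 0 m) ≠ ∞ :=
      ((measure_mono inter_subset_right).trans_lt measure_closedBall_lt_top).ne
    have hlim : Tendsto (fun ε ↦ 2 ^ d * ENNReal.ofReal ε * μ (B ∩ closedBall 0 m)) (𝓝[>] 0)
        (𝓝 (2 ^ d * ENNReal.ofReal 0 * μ (B ∩ closedBall 0 m))) := by
      refine ENNReal.Tendsto.mul_const (ENNReal.Tendsto.const_mul ?_ (.inr (by simp)))
        (.inr hfin)
      exact (ENNReal.continuous_ofReal.tendsto 0).mono_left nhdsWithin_le_nhds
    have hle := ge_of_tendsto hlim (eventually_mem_nhdsWithin.mono fun ε hε ↦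
      hbound _ inter_subset_left (hB.inter measurableSet_closedBall) ε hε)
    simpa using hle
  have hcover : f '' B = ⋃ m : ℕ, f '' (B ∩ closedBall 0 m) := by
    rw [← image_iUnion, ← inter_iUnion, iUnion_closedBall_nat, inter_univ]
  rw [hcover]
  exact measure_iUnion_null hpiece

end CollapsedSet

section BiLipschitzPieces

theorem exists_antilipschitz_partition_of_injective_fderiv {E F : Type*} [NormedAddCommGroup E]
    [NormedSpace ℝ E] [FiniteDimensional ℝ E] [MeasurableSpace E] [BorelSpace E]
    [NormedAddCommGroup F] [NormedSpace ℝ F] [SecondCountableTopology F] {Φ : E → F} {s : Set E}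
    (hs : ∀ x ∈ s, DifferentiableAt ℝ Φ x ∧ Function.Injective (fderiv ℝ Φ x)) :
    ∃ t : ℕ → Set E, (∀ i, MeasurableSet (t i)) ∧ s ⊆ ⋃ i, t i ∧
      ∀ i, ∃ c : ℝ, 0 < c ∧ ∀ a ∈ s ∩ t i, ∀ b ∈ s ∩ t i, c * dist a b ≤ dist (Φ a) (Φ b) := by
  have hr : ∀ A : E →L[ℝ] F, ∃ r : ℝ≥0, r ≠ 0 ∧
      (Function.Injective A → ∀ v, 2 * r * ‖v‖ ≤ ‖A v‖) := by
    intro A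
    by_cases hA : Function.Injective A
    · obtain ⟨k, hk, hAk⟩ := (LinearMap.injective_iff_antilipschitz (A : E →ₗ[ℝ] F)).1 hA
      refine ⟨(2 * k)⁻¹, by positivity, fun _ v ↦ ?_⟩
      have h1 : ‖v‖ ≤ k * ‖A v‖ := by simpa [dist_eq_norm] using hAk.le_mul_dist v 0
      have hk : (0 : ℝ) < k := hk
      push_cast
      calc 2 * (2 * (k : ℝ))⁻¹ * ‖v‖ ≤ 2 * (2 * (k : ℝ))⁻¹ * (k * ‖A v‖) := by gcongr
        _ = ‖A v‖ := by field_simp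
    · exact ⟨1, one_ne_zero, fun h ↦ absurd h hA⟩
  choose r hr0 hrA using hr
  obtain ⟨t, A, -, htm, hst, happ, hAs⟩ :=
    exists_partition_approximatesLinearOn_of_hasFDerivWithinAt Φ s (fderiv ℝ Φ)
      (fun x hx ↦ (hs x hx).1.hasFDerivAt.hasFDerivWithinAt) r hr0
  refine ⟨t, htm, hst, fun i ↦ ⟨r (A i), by have := hr0 (A i); positivity, fun a ha b hb ↦ ?_⟩⟩
  obtain ⟨y, hy, hAy⟩ := hAs ⟨a, ha.1⟩ i
  have h1 := hrA (A i) (hAy ▸ (hs y hy).2) (a - b)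
  have h2 := happ i a ha b hb
  rw [dist_eq_norm, dist_eq_norm]
  linarith [norm_le_norm_add_norm_sub (Φ a - Φ b) (A i (a - b))]

theorem exists_injective_pi_of_forall_exists_ne_zero {E : Type*} [NormedAddCommGroup E]
    [NormedSpace ℝ E] [FiniteDimensional ℝ E] (S : ℕ → E →L[ℝ] ℝ)
    (hS : ∀ v, v ≠ 0 → ∃ j, S j v ≠ 0) :
    ∃ N, Function.Injective (ContinuousLinearMap.pi fun j : Fin N ↦ S j) := by
  obtain ⟨N, hN⟩ := (isCompact_sphere (0 : E) 1).elim_directed_cover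
    (fun N ↦ ⋃ j : Fin N, {v | S j v ≠ 0})
    (fun N ↦ isOpen_iUnion fun j ↦ isOpen_ne_fun (S j).continuous continuous_const)
    (fun v hv ↦ by
      obtain ⟨j, hj⟩ := hS v (ne_zero_of_mem_unit_sphere ⟨v, hv⟩)
      exact mem_iUnion.2 ⟨j + 1, mem_iUnion.2 ⟨Fin.last j, by simpa using hj⟩⟩)
    (directed_of_isDirected_le fun M N hMN ↦ iUnion_subset fun j ↦
      subset_iUnion (fun j : Fin N ↦ {v | S j v ≠ 0}) (Fin.castLE hMN j))
  refine ⟨N, (injective_iff_map_eq_zero _).2 fun v hv ↦ by_contra fun hv0 ↦ ?_⟩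
  obtain ⟨j, hj⟩ := mem_iUnion.1 (hN (show ‖v‖⁻¹ • v ∈ sphere (0 : E) 1 by
    rw [mem_sphere_zero_iff_norm, norm_smul, norm_inv, norm_norm,
      inv_mul_cancel₀ (norm_ne_zero_iff.2 hv0)]))
  exact hj (by simpa using Or.inr (congrFun hv j))

theorem exists_lipschitzWith_controlsDistOn {X E : Type*} [MetricSpace X] [MetricSpace E]
    [SecondCountableTopology E] {f : E → X} {F : Set E} {K : ℝ≥0} (hf : LipschitzOnWith K f F)
    (hF : F.Nonempty) :
    ∃ φ : ℕ → E → ℝ, (∀ j, LipschitzWith K (φ j)) ∧ ControlsDistOn φ f F ∧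
      ∀ x ∈ F, ∀ y ∈ F, ∀ j, |φ j x - φ j y| ≤ dist (f x) (f y) := by
  have : Nonempty F := hF.to_subtype
  set p := TopologicalSpace.denseSeq F
  have hp : DenseRange p := TopologicalSpace.denseRange_denseSeq F
  have hlip : ∀ j, LipschitzOnWith K (fun x ↦ dist (f x) (f (p j))) F := fun j ↦
    LipschitzOnWith.of_dist_le_mul fun x hx y hy ↦
      (dist_dist_dist_le_left _ _ _).trans (hf.dist_le_mul x hx y hy)
  choose φ hφ hφeq using fun j ↦ (hlip j).extend_real
  refine ⟨φ, hφ, fun x hx y hy c hc ↦ ?_, fun x hx y hy j ↦ ?_⟩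
  · refine le_of_forall_pos_le_add fun ε hε ↦ ?_
    obtain ⟨j, hj⟩ := hp.exists_dist_lt ⟨y, hy⟩ (show 0 < ε / (2 * (K + 1)) by positivity)
    have h1 : dist (f y) (f (p j)) ≤ ε / 2 := by
      calc dist (f y) (f (p j)) ≤ K * dist y (p j) := hf.dist_le_mul y hy _ (p j).2
        _ ≤ (K + 1) * (ε / (2 * (K + 1))) := by gcongr; exacts [by simp, hj.le]
        _ = ε / 2 := by field_simp
    have h2 := (abs_le.1 (hc j)).2
    rw [← hφeq j hx, ← hφeq j hy] at h2
    linarith [dist_triangle_right (f x) (f y) (f (p j))]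
  · rw [← hφeq j hx, ← hφeq j hy]
    exact dist_dist_dist_le_left _ _ _

theorem exists_biLipschitz_pieces {X E : Type*} [MetricSpace X] [MeasurableSpace X] [BorelSpace X]
    [NormedAddCommGroup E] [InnerProductSpace ℝ E] [FiniteDimensional ℝ E] [MeasurableSpace E]
    [BorelSpace E] {f : E → X} {F : Set E} {K : ℝ≥0} (hF : MeasurableSet F)
    (hf : LipschitzOnWith K f F) :
    ∃ G : ℕ → Set E, (∀ i, MeasurableSet (G i)) ∧
      (∀ i, ∃ L : ℝ, 1 ≤ L ∧ ∀ a ∈ G i, ∀ b ∈ G i,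
        L⁻¹ * dist a b ≤ dist (f a) (f b) ∧ dist (f a) (f b) ≤ L * dist a b) ∧
      μH[Module.finrank ℝ E] (f '' (F \ ⋃ i, G i)) = 0 := by
  rcases F.eq_empty_or_nonempty with rfl | hne
  · exact ⟨fun _ ↦ ∅, fun _ ↦ .empty, fun _ ↦ ⟨1, le_rfl, by simp⟩, by simp⟩
  obtain ⟨φ, hφ, hctrl, hφf⟩ := exists_lipschitzWith_controlsDistOn hf hne
  have : (μH[Module.finrank ℝ E] : Measure E).IsAddHaarMeasure :=
    isAddHaarMeasure_hausdorffMeasure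
  set Φ : (N : ℕ) → E → Fin N → ℝ := fun N x j ↦ φ j x
  set D : Set E := ⋂ j, {x | DifferentiableAt ℝ (φ j) x}
  have hD : MeasurableSet D := .iInter fun j ↦ measurableSet_of_differentiableAt ℝ (φ j)
  have hDae : ∀ᵐ x ∂(μH[Module.finrank ℝ E] : Measure E), x ∈ D :=
    (ae_all_iff.2 fun j ↦ (hφ j).ae_differentiableAt).mono fun x hx ↦ mem_iInter.2 hx
  have hΦ : ∀ N, ∀ x ∈ D, HasFDerivAt (Φ N)
      (ContinuousLinearMap.pi fun j : Fin N ↦ fderiv ℝ (φ j) x) x := fun N x hx ↦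
    hasFDerivAt_pi.2 fun j ↦ DifferentiableAt.hasFDerivAt (mem_iInter.1 hx j)
  set s : ℕ → Set E := fun N ↦ F ∩ D ∩ fderiv ℝ (Φ N) ⁻¹' {A | Function.Injective A}
  have hs : ∀ N, MeasurableSet (s N) := fun N ↦ (hF.inter hD).inter
    (measurable_fderiv ℝ (Φ N) ContinuousLinearMap.isOpen_injective.measurableSet)
  choose t htm hst c hc hct using fun N ↦ exists_antilipschitz_partition_of_injective_fderiv
    (s := s N) (Φ := Φ N) fun x hx ↦ ⟨(hΦ N x hx.1.2).differentiableAt, hx.2⟩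
  set G : ℕ → Set E := fun i ↦ s i.unpair.1 ∩ t i.unpair.1 i.unpair.2
  have hG : ∀ i, MeasurableSet (G i) := fun i ↦ (hs _).inter (htm _ _)
  have hsG : ∀ N, s N ⊆ ⋃ i, G i := fun N x hx ↦ by
    obtain ⟨k, hk⟩ := mem_iUnion.1 (hst N hx)
    exact mem_iUnion.2 ⟨Nat.pair N k, by simpa [G] using ⟨hx, hk⟩⟩
  refine ⟨G, hG, fun i ↦ ?_, ?_⟩
  · have hci := hc i.unpair.1 i.unpair.2
    refine ⟨max 1 (max K (c i.unpair.1 i.unpair.2)⁻¹), le_max_left _ _, fun a ha b hb ↦ ⟨?_, ?_⟩⟩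
    · calc _ ≤ c i.unpair.1 i.unpair.2 * dist a b := by
            gcongr
            exact inv_le_of_inv_le₀ hci ((le_max_right _ _).trans (le_max_right _ _))
        _ ≤ dist (Φ i.unpair.1 a) (Φ i.unpair.1 b) := hct _ _ a ha b hb
        _ ≤ dist (f a) (f b) := (dist_pi_le_iff dist_nonneg).2 fun j ↦
            hφf a ha.1.1.1 b hb.1.1.1 j
    · refine (hf.dist_le_mul a ha.1.1.1 b hb.1.1.1).trans ?_
      gcongr
      exact (le_max_left _ _).trans (le_max_right _ _)
  · have hsplit : F \ ⋃ i, G i ⊆ (F \ D) ∪ ((F ∩ D) \ ⋃ i, G i) := fun x hx ↦ by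
      by_cases hxD : x ∈ D
      · exact .inr ⟨⟨hx.1, hxD⟩, hx.2⟩
      · exact .inl ⟨hx.1, hxD⟩
    refine measure_mono_null ((image_mono hsplit).trans_eq (image_union _ _ _))
      (measure_union_null ?_ ?_)
    · exact (hf.mono sdiff_subset).hausdorffMeasure_image_eq_zero (Nat.cast_nonneg _)
        (measure_mono_null (fun x hx ↦ hx.2) hDae)
    · refine hausdorffMeasure_image_eq_zero_of_degenerate ((hF.inter hD).diff (.iUnion hG)) hφ
        (hctrl.mono fun x hx ↦ hx.1.1) fun x hx ↦ ?_
      by_contra! hcon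
      obtain ⟨N, hN⟩ := exists_injective_pi_of_forall_exists_ne_zero
        (fun j ↦ fderiv ℝ (φ j) x) hcon
      refine hx.2 (hsG N ⟨hx.1, ?_⟩)
      rwa [mem_preimage, (hΦ N x hx.1.2).fderiv]

end BiLipschitzPieces

/-- Kirchheim's theorem: an `H^n`-measurable set `E ⊆ X` is `n`-rectifiable via Lipschitz
images of measurable subsets of `ℝ^n` if and only if it is `n`-rectifiable via bi-Lipschitz
images of measurable subsets of `ℝ^n`. -/
theorem stmt11 {X : Type*} [MetricSpace X] [MeasurableSpace X] [BorelSpace X]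
    (n : ℕ) (E : Set X) (hE : MeasurableSet E) :
    (∃ (F : ℕ → Set (EuclideanSpace ℝ (Fin n))) (f : ℕ → EuclideanSpace ℝ (Fin n) → X),
      (∀ i, MeasurableSet (F i)) ∧ (∀ i, ∃ K : ℝ≥0, LipschitzOnWith K (f i) (F i)) ∧
      μH[n] (E \ ⋃ i, f i '' F i) = 0) ↔
    (∃ (G : ℕ → Set (EuclideanSpace ℝ (Fin n))) (g : ℕ → EuclideanSpace ℝ (Fin n) → X),
      (∀ i, MeasurableSet (G i)) ∧
      (∀ i, ∃ L : ℝ, 1 ≤ L ∧ ∀ a ∈ G i, ∀ b ∈ G i,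
        L⁻¹ * dist a b ≤ dist (g i a) (g i b) ∧ dist (g i a) (g i b) ≤ L * dist a b) ∧
      μH[n] (E \ ⋃ i, g i '' G i) = 0) := by
  constructor
  · rintro ⟨F, f, hF, hf, hE0⟩
    choose K hK using hf
    have hpieces := fun i ↦ exists_biLipschitz_pieces (hF i) (hK i)
    simp only [finrank_euclideanSpace_fin] at hpieces
    choose G hG hbi hG0 using hpieces
    refine ⟨fun i ↦ G i.unpair.1 i.unpair.2, fun i ↦ f i.unpair.1, fun i ↦ hG _ _,
      fun i ↦ hbi _ _, ?_⟩
    refine measure_mono_null (fun x hx ↦ ?_) (measure_union_null hE0 (measure_iUnion_null hG0))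
    by_cases hxF : x ∈ ⋃ i, f i '' F i
    · obtain ⟨i, a, ha, rfl⟩ := mem_iUnion.1 hxF
      refine .inr (mem_iUnion.2 ⟨i, a, ⟨ha, fun haG ↦ hx.2 ?_⟩, rfl⟩)
      obtain ⟨k, hk⟩ := mem_iUnion.1 haG
      exact mem_iUnion.2 ⟨Nat.pair i k, a, by simpa using hk, by simp⟩
    · exact .inl ⟨hx.1, hxF⟩
  · rintro ⟨G, g, hG, hg, hE0⟩
    refine ⟨G, g, hG, fun i ↦ ?_, hE0⟩
    obtain ⟨L, hL, hgL⟩ := hg i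
    refine ⟨L.toNNReal, LipschitzOnWith.of_dist_le_mul fun a ha b hb ↦ ?_⟩
    rw [Real.coe_toNNReal L (by linarith)]
    exact (hgL a ha b hb).2
end

section
/- Let X be a compact, connected metric space containing more than one point, with H^1(X) < ∞. Then there exists a surjective Lipschitz map f : [0,1] → X. -/
open MeasureTheory Metric Set Filter
open scoped ENNReal NNReal Topology

/-- In a connected space, a ball which is not the whole space has `H^1`-measure at least its
radius. -/
theorem ofReal_le_hausdorffMeasure_ball {X : Type*} [MetricSpace X] [MeasurableSpace X]
    [BorelSpace X] [PreconnectedSpace X] {x y : X} {r : ℝ} (hy : r ≤ dist y x) :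
    ENNReal.ofReal r ≤ μH[1] (ball x r) := by
  have hlip : LipschitzWith 1 (fun z : X ↦ dist z x) := LipschitzWith.dist_left x
  have hsub : Ico 0 r ⊆ (fun z : X ↦ dist z x) '' ball x r := by
    intro t ht
    obtain ⟨z, hz⟩ := intermediate_value_univ x y hlip.continuous
      (show t ∈ Icc (dist x x) (dist y x) from ⟨by simpa using ht.1, ht.2.le.trans hy⟩)
    exact ⟨z, mem_ball.2 (lt_of_eq_of_lt hz ht.2), hz⟩
  calc ENNReal.ofReal r = μH[1] (Ico 0 r) := by rw [hausdorffMeasure_real]; simp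
    _ ≤ μH[1] ((fun z : X ↦ dist z x) '' ball x r) := measure_mono hsub
    _ ≤ μH[1] (ball x r) := by
      simpa using (hlip.lipschitzOnWith (s := ball x r)).hausdorffMeasure_image_le zero_le_one

/-- The cardinality of an `ε`-separated set is controlled by the `H^1`-measure of the space. -/
theorem card_mul_le_hausdorffMeasure {X : Type*} [MetricSpace X] [MeasurableSpace X]
    [BorelSpace X] [PreconnectedSpace X] (hfin : μH[1] (univ : Set X) < ∞) {a b : X} {ε : ℝ}
    (hε : 0 < ε) (hab : ε ≤ dist a b) {S : Finset X}
    (hS : (S : Set X).Pairwise fun s t ↦ ε < dist s t) :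
    S.card * (ε / 2) ≤ (μH[1] (univ : Set X)).toReal := by
  have hball (s : X) : ENNReal.ofReal (ε / 2) ≤ μH[1] (ball s (ε / 2)) := by
    by_cases ha : ε / 2 ≤ dist a s
    · exact ofReal_le_hausdorffMeasure_ball ha
    · refine ofReal_le_hausdorffMeasure_ball (y := b) ?_
      have := dist_triangle_right a b s
      linarith
  have hdisj : (S : Set X).PairwiseDisjoint fun s ↦ ball s (ε / 2) := by
    intro s hs t ht hst
    exact ball_disjoint_ball (by linarith [hS hs ht hst])
  have hle : S.card * ENNReal.ofReal (ε / 2) ≤ μH[1] (univ : Set X) :=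
    calc S.card * ENNReal.ofReal (ε / 2) = ∑ s ∈ S, ENNReal.ofReal (ε / 2) := by simp
      _ ≤ ∑ s ∈ S, μH[1] (ball s (ε / 2)) := Finset.sum_le_sum fun s _ ↦ hball s
      _ = μH[1] (⋃ s ∈ S, ball s (ε / 2)) :=
        (measure_biUnion_finset hdisj fun s _ ↦ measurableSet_ball).symm
      _ ≤ μH[1] (univ : Set X) := measure_mono (subset_univ _)
  have := ENNReal.toReal_mono hfin.ne hle
  rwa [ENNReal.toReal_mul, ENNReal.toReal_natCast, ENNReal.toReal_ofReal (by positivity)] at this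

/-- The graph joining distinct points at distance at most `δ`. -/
def proximityGraph (X : Type*) [MetricSpace X] (δ : ℝ) : SimpleGraph X where
  Adj x y := x ≠ y ∧ dist x y ≤ δ
  symm := ⟨fun x y h ↦ ⟨h.1.symm, dist_comm x y ▸ h.2⟩⟩
  loopless := ⟨fun _ h ↦ h.1 rfl⟩

/-- In a connected space, a finite set whose closed `ε`-neighbourhood is not everything has a
point outside this neighbourhood at distance at most `2 * ε`. -/
theorem exists_separated_near {X : Type*} [MetricSpace X] [PreconnectedSpace X] {ε : ℝ}
    (hε : 0 < ε) {S : Finset X} (hS : S.Nonempty) (hcov : ¬ ∀ x, ∃ s ∈ S, dist s x ≤ ε) :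
    ∃ q, (∀ s ∈ S, ε < dist s q) ∧ ∃ s ∈ S, dist s q ≤ 2 * ε := by
  by_contra! hq
  let U : Set X := ⋃ s ∈ S, closedBall s ε
  have hmem (x : X) : x ∈ U ↔ ∃ s ∈ S, dist s x ≤ ε := by
    simp [U, dist_comm]
  have hclosed : IsClosed U := S.finite_toSet.isClosed_biUnion fun s _ ↦ isClosed_closedBall
  have hopen : IsOpen U := by
    refine isOpen_iff.2 fun p hp ↦ ⟨ε, hε, fun q hqp ↦ ?_⟩
    by_contra hqU
    obtain ⟨s, hs, hsp⟩ := (hmem p).1 hp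
    have hfar : ∀ t ∈ S, ε < dist t q := by
      intro t ht
      by_contra! h
      exact hqU ((hmem q).2 ⟨t, ht, h⟩)
    have := dist_triangle s p q
    linarith [hq q hfar s hs, mem_ball'.1 hqp]
  obtain ⟨s, hs⟩ := hS
  have huniv : U = univ :=
    IsClopen.eq_univ ⟨hclosed, hopen⟩ ⟨s, (hmem s).2 ⟨s, hs, by simpa using hε.le⟩⟩
  exact hcov fun x ↦ (hmem x).1 (huniv ▸ mem_univ x)

/-- A walk with steps of size at most `2 * ε` through an `ε`-separated set `S` of controlled
size, where `S` either is an `ε`-net or has at least `n` elements. -/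
theorem exists_walk_through_separated {X : Type*} [MetricSpace X] [ConnectedSpace X] {ε : ℝ}
    (hε : 0 < ε) (n : ℕ) :
    ∃ (S : Finset X) (x y : X) (w : (proximityGraph X (2 * ε)).Walk x y),
      S.Nonempty ∧ (S : Set X).Pairwise (fun s t ↦ ε < dist s t) ∧ (∀ s ∈ S, s ∈ w.support) ∧
      w.length ≤ 2 * S.card ∧ ((∀ x, ∃ s ∈ S, dist s x ≤ ε) ∨ n ≤ S.card) := by
  classical
  induction n with
  | zero =>
    obtain ⟨x⟩ := (inferInstance : Nonempty X)
    exact ⟨{x}, x, x, .nil, by simp⟩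
  | succ n ih =>
    obtain ⟨S, x, y, w, hne, hsep, hsupp, hlen, h⟩ := ih
    by_cases hcov : ∀ x, ∃ s ∈ S, dist s x ≤ ε
    · exact ⟨S, x, y, w, hne, hsep, hsupp, hlen, .inl hcov⟩
    obtain ⟨q, hfar, s, hs, hsq⟩ := exists_separated_near hε hne hcov
    have hqS : q ∉ S := fun hq ↦ by simpa using hε.trans (hfar q hq)
    have hadj : (proximityGraph X (2 * ε)).Adj s q := ⟨fun h ↦ hqS (h ▸ hs), hsq⟩
    let w' := (w.takeUntil s (hsupp s hs)).append
      (.cons hadj (.cons hadj.symm (w.dropUntil s (hsupp s hs))))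
    refine ⟨insert q S, x, y, w', by simp, ?_, ?_, ?_, .inr ?_⟩
    · rw [Finset.coe_insert]
      refine hsep.insert fun t ht _ ↦ ⟨?_, hfar t ht⟩
      rw [dist_comm]
      exact hfar t ht
    · intro t ht
      rcases Finset.mem_insert.1 ht with rfl | ht
      · simp [w', SimpleGraph.Walk.mem_support_append_iff]
      · have := hsupp t ht
        rw [← w.take_spec (hsupp s hs), SimpleGraph.Walk.mem_support_append_iff] at this
        simp only [w', SimpleGraph.Walk.mem_support_append_iff, SimpleGraph.Walk.support_cons,
          List.mem_cons]
        tauto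
    · have := congrArg SimpleGraph.Walk.length (w.take_spec (hsupp s hs))
      rw [SimpleGraph.Walk.length_append] at this
      simp only [w', SimpleGraph.Walk.length_append, SimpleGraph.Walk.length_cons,
        Finset.card_insert_of_notMem hqS]
      omega
    · rw [Finset.card_insert_of_notMem hqS]
      have := h.resolve_left hcov
      omega

theorem dist_getVert_le {X : Type*} [MetricSpace X] {δ : ℝ} (hδ : 0 ≤ δ) {x y : X}
    (w : (proximityGraph X δ).Walk x y) {i j : ℕ} (hij : i ≤ j) :
    dist (w.getVert i) (w.getVert j) ≤ (j - i) * δ := by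
  have hstep (k : ℕ) : dist (w.getVert k) (w.getVert (k + 1)) ≤ δ := by
    by_cases hk : k < w.length
    · exact (w.adj_getVert_succ hk).2
    · rw [w.getVert_of_length_le (by omega), w.getVert_of_length_le (by omega), dist_self]
      exact hδ
  have := dist_le_Ico_sum_of_dist_le (f := w.getVert) (d := fun _ ↦ δ) hij fun {k} _ _ ↦ hstep k
  simpa [Nat.cast_sub hij] using this

/-- Coarse version of the parametrization: at scale `ε`, the space is `ε`-covered by a map
which is Lipschitz up to an error `2 * ε`. -/
theorem exists_coarse_parametrization {X : Type*} [MetricSpace X] [MeasurableSpace X]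
    [BorelSpace X] [ConnectedSpace X] (hfin : μH[1] (univ : Set X) < ∞) {a b : X} {ε : ℝ}
    (hε : 0 < ε) (hab : ε ≤ dist a b) :
    ∃ g : Icc (0 : ℝ) 1 → X,
      (∀ s t, dist (g s) (g t) ≤ 8 * (μH[1] (univ : Set X)).toReal * dist s t + 2 * ε) ∧
      ∀ x, ∃ t, dist (g t) x ≤ ε := by
  obtain ⟨n, hn⟩ := exists_nat_gt ((μH[1] (univ : Set X)).toReal / (ε / 2))
  obtain ⟨S, x, y, w, -, hsep, hsupp, hlen, h⟩ := exists_walk_through_separated (X := X) hε n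
  have hcard := card_mul_le_hausdorffMeasure hfin hε hab hsep
  have hnet : ∀ x, ∃ s ∈ S, dist s x ≤ ε := by
    refine h.resolve_right fun hnS ↦ ?_
    rw [div_lt_iff₀ (by positivity)] at hn
    have : (n : ℝ) * (ε / 2) ≤ S.card * (ε / 2) := by gcongr
    linarith
  have hN : w.length * (2 * ε) ≤ 8 * (μH[1] (univ : Set X)).toReal := by
    have : (w.length : ℝ) ≤ 2 * S.card := by exact_mod_cast hlen
    nlinarith
  have hcoarse {s t : Icc (0 : ℝ) 1} (hst : s ≤ t) :
      dist (w.getVert ⌊(s : ℝ) * w.length⌋₊) (w.getVert ⌊(t : ℝ) * w.length⌋₊) ≤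
        8 * (μH[1] (univ : Set X)).toReal * dist s t + 2 * ε := by
    have hst' : (s : ℝ) ≤ t := hst
    have hd : dist s t = t - s := by
      rw [Subtype.dist_eq, dist_comm, Real.dist_eq, abs_of_nonneg (sub_nonneg.2 hst')]
    have h1 := dist_getVert_le (by positivity) w
      (Nat.floor_le_floor (mul_le_mul_of_nonneg_right hst' (Nat.cast_nonneg w.length)))
    have h2 := Nat.floor_le (mul_nonneg t.2.1 (Nat.cast_nonneg (α := ℝ) w.length))
    have h3 := Nat.lt_floor_add_one ((s : ℝ) * w.length)
    calc _ ≤ _ := h1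
      _ ≤ ((t - s) * w.length + 1) * (2 * ε) := by gcongr; linarith
      _ = w.length * (2 * ε) * (t - s) + 2 * ε := by ring
      _ ≤ _ := by rw [hd]; gcongr
  refine ⟨fun t ↦ w.getVert ⌊(t : ℝ) * w.length⌋₊, fun s t ↦ ?_, fun z ↦ ?_⟩
  · rcases le_total s t with hst | hst
    · exact hcoarse hst
    · rw [dist_comm, dist_comm s]
      exact hcoarse hst
  · obtain ⟨s, hs, hsz⟩ := hnet z
    obtain ⟨i, rfl, hi⟩ := SimpleGraph.Walk.mem_support_iff_exists_getVert.1 (hsupp s hs)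
    refine ⟨⟨i / w.length, by positivity, div_le_one_of_le₀ (by exact_mod_cast hi)
      (by positivity)⟩, ?_⟩
    rcases Nat.eq_zero_or_pos w.length with h0 | h0
    · obtain rfl : i = 0 := by omega
      simpa using hsz
    · have h1 : (i / w.length * w.length : ℝ) = i := div_mul_cancel₀ _ (by positivity)
      simpa only [h1, Nat.floor_natCast] using hsz

/-- A limit of coarsely Lipschitz, coarsely surjective maps between compact spaces, with errors
tending to zero, yields a Lipschitz surjection. -/
theorem exists_lipschitzWith_surjective_of_coarse {T X : Type*} [PseudoMetricSpace T]
    [CompactSpace T] [MetricSpace X] [CompactSpace X] {K : ℝ≥0} {ε : ℕ → ℝ}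
    (hε : Tendsto ε atTop (𝓝 0)) (g : ℕ → T → X)
    (hg : ∀ k s t, dist (g k s) (g k t) ≤ K * dist s t + 2 * ε k)
    (hsurj : ∀ k x, ∃ t, dist (g k t) x ≤ ε k) :
    ∃ f : T → X, LipschitzWith K f ∧ Function.Surjective f := by
  let U : Ultrafilter ℕ := hyperfilter ℕ
  have hεU : Tendsto ε U (𝓝 0) := hε.mono_left Nat.hyperfilter_le_atTop
  have hlim (t : T) : ∃ x, Tendsto (fun k ↦ g k t) U (𝓝 x) :=
    ⟨_, (U.map fun k ↦ g k t).le_nhds_lim⟩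
  choose f hf using hlim
  refine ⟨f, LipschitzWith.of_dist_le_mul fun s t ↦ ?_, fun x ↦ ?_⟩
  · have hrhs : Tendsto (fun k ↦ K * dist s t + 2 * ε k) U (𝓝 (K * dist s t)) := by
      simpa using (hεU.const_mul 2).const_add (K * dist s t)
    exact le_of_tendsto_of_tendsto' ((hf s).dist (hf t)) hrhs fun k ↦ hg k s t
  · choose u hu using fun k ↦ hsurj k x
    obtain ⟨t, ht⟩ : ∃ t, Tendsto u U (𝓝 t) := ⟨_, (U.map u).le_nhds_lim⟩
    refine ⟨t, tendsto_nhds_unique (hf t) (tendsto_iff_dist_tendsto_zero.2 ?_)⟩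
    have hrhs : Tendsto (fun k ↦ K * dist t (u k) + 2 * ε k + ε k) U (𝓝 0) := by
      simpa using ((((tendsto_const_nhds (x := t)).dist ht).const_mul (K : ℝ)).add
        (hεU.const_mul 2)).add hεU
    refine squeeze_zero (fun _ ↦ dist_nonneg) (fun k ↦ ?_) hrhs
    linarith [dist_triangle (g k t) (g k (u k)) x, hg k t (u k), hu k]

/-- A compact, connected metric space with more than one point and finite `H^1`-measure is
the image of a Lipschitz surjection from `[0,1]`. -/
theorem stmt12 {X : Type*} [MetricSpace X] [MeasurableSpace X] [BorelSpace X]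
    [CompactSpace X] [ConnectedSpace X] [Nontrivial X]
    (hfin : μH[1] (univ : Set X) < ∞) :
    ∃ f : Set.Icc (0 : ℝ) 1 → X, (∃ K : ℝ≥0, LipschitzWith K f) ∧ Function.Surjective f := by
  obtain ⟨a, b, hab⟩ := exists_pair_ne X
  have hD : 0 < dist a b := dist_pos.2 hab
  have hpos (k : ℕ) : 0 < dist a b / (k + 1) := by positivity
  have hle (k : ℕ) : dist a b / (k + 1) ≤ dist a b :=
    div_le_self hD.le (by linarith [Nat.cast_nonneg (α := ℝ) k])
  choose g hg hsurj using fun k ↦ exists_coarse_parametrization hfin (hpos k) (hle k)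
  have hε : Tendsto (fun k : ℕ ↦ dist a b / (k + 1)) atTop (𝓝 0) := by
    simpa [div_eq_mul_inv] using (tendsto_one_div_add_atTop_nhds_zero_nat (𝕜 := ℝ)).const_mul
      (dist a b)
  obtain ⟨f, hf, hfs⟩ := exists_lipschitzWith_surjective_of_coarse
    (K := 8 * (μH[1] (univ : Set X)).toNNReal) hε g hg hsurj
  exact ⟨f, ⟨_, hf⟩, hfs⟩
end
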